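/- Let X be a real Banach algebra with identity satisfying the sequential condition (P), and let S be a nonempty, closed and convex subset of X. Let A, C : X → X and B : S → X be weakly sequentially continuous operators such that: (i) A and C are Lipschitz with constants a and c respectively; (ii) A x is invertible in X for every x ∈ X; (iii) A(S), B(S) and C(S) are relatively weakly compact; (iv) whenever x ∈ X satisfies x = A x · B y + C x for some y ∈ S, then x ∈ S. If β·a + c < 1, where β = sup{‖B y‖ : y ∈ S}, then there exists x ∈ S with x = A x · B x + C x. -/

import Mathlib

open Filter Topology Pointwise

variable {X : Type*} [NormedAddCommGroup X] [NormedSpace ℝ X]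

/-- `u` converges weakly to `x`. -/
def WeakConv (u : ℕ → X) (x : X) : Prop :=
  ∀ f : X →L[ℝ] ℝ, Tendsto (fun n => f (u n)) atTop (𝓝 (f x))

/-- A set is weakly compact if it is compact in the weak topology `σ(X, X*)`. -/
def WeaklyCompact (K : Set X) : Prop :=
  IsCompact (toWeakSpace ℝ X '' K)

/-- The closure of a set in the weak topology. -/
def weakClosure (S : Set X) : Set X :=
  toWeakSpace ℝ X ⁻¹' closure (toWeakSpace ℝ X '' S)

/-- A set is relatively weakly compact if its weak closure is weakly compact. -/
def RelWeaklyCompact (S : Set X) : Prop :=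
  WeaklyCompact (weakClosure S)

/-- The De Blasi measure of weak noncompactness. -/
noncomputable def deBlasi (S : Set X) : ℝ :=
  sInf {r : ℝ | 0 ≤ r ∧ ∃ K : Set X, WeaklyCompact K ∧ S ⊆ K + Metric.closedBall (0 : X) r}
/-- Condition (P): the product of weakly convergent sequences converges weakly to the
product of the limits. -/
def CondP (X : Type*) [NormedRing X] [NormedAlgebra ℝ X] : Prop :=
  ∀ (u v : ℕ → X) (x y : X), WeakConv u x → WeakConv v y →
    WeakConv (fun n => u n * v n) (x * y)

theorem exists_extrapolation_weights (n : ℕ) {δ : ℝ} (hδ : 0 < δ) :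
    ∃ t w : Fin (n + 1) → ℝ, (∀ i, 0 ≤ t i ∧ t i ≤ δ) ∧
      ∀ p : Polynomial ℝ, p.natDegree ≤ n → p.eval 1 = ∑ i, w i * p.eval (t i) := by
  let t : Fin (n + 1) → ℝ := fun i => δ * (i / (n + 1))
  have ht : Set.InjOn t (Finset.univ : Finset (Fin (n + 1))) := by
    intro i _ j _ hij
    have hn : (n + 1 : ℝ) ≠ 0 := by positivity
    have := mul_left_cancel₀ hδ.ne' hij
    rw [div_left_inj' hn] at this
    exact Fin.ext (by exact_mod_cast this)
  refine ⟨t, fun i => (Lagrange.basis Finset.univ t i).eval 1, fun i => ⟨by positivity, ?_⟩, ?_⟩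
  · refine mul_le_of_le_one_right hδ.le (div_le_one_of_le₀ ?_ (by positivity))
    exact_mod_cast i.2.le
  · intro p hp
    have hdeg : p.degree < (Finset.univ : Finset (Fin (n + 1))).card := by
      rw [Finset.card_fin]
      exact lt_of_le_of_lt Polynomial.degree_le_natDegree (by exact_mod_cast Nat.lt_succ_of_le hp)
    conv_lhs => rw [Lagrange.eq_interpolate ht hdeg]
    simp [Lagrange.interpolate_apply, Polynomial.eval_finsetSum, mul_comm]

theorem exists_polynomial_det_one_add_smul {E : Type*} [NormedAddCommGroup E] [NormedSpace ℝ E]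
    [FiniteDimensional ℝ E] (M : E →L[ℝ] E) :
    ∃ p : Polynomial ℝ, p.natDegree ≤ Module.finrank ℝ E ∧
      ∀ t : ℝ, (ContinuousLinearMap.id ℝ E + t • M).det = p.eval t := by
  let b := Module.finBasis ℝ E
  let m := LinearMap.toMatrix b b M
  refine ⟨_, (Polynomial.natDegree_det_X_add_C_le m 1).trans (by simp), fun t => ?_⟩
  rw [ContinuousLinearMap.det, ← LinearMap.det_toMatrix b, ← Polynomial.coe_evalRingHom,
    RingHom.map_det]
  congr 1
  ext i j
  simp [m, LinearMap.toMatrix_apply, Matrix.one_apply, Finsupp.single_apply, eq_comm]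
  split_ifs <;> simp [mul_comm, add_comm]

theorem ContinuousLinearMap.det_id_add_pos {E : Type*} [NormedAddCommGroup E] [NormedSpace ℝ E]
    [FiniteDimensional ℝ E] {T : E →L[ℝ] E} (hT : ‖T‖ < 1) :
    0 < (ContinuousLinearMap.id ℝ E + T).det := by
  have : CompleteSpace E := FiniteDimensional.complete ℝ E
  have hne : ∀ s ∈ Set.Icc (0 : ℝ) 1, (ContinuousLinearMap.id ℝ E + s • T).det ≠ 0 := by
    intro s hs
    have h1 : ‖-(s • T)‖ < 1 := by
      rw [norm_neg, norm_smul, Real.norm_of_nonneg hs.1]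
      exact lt_of_le_of_lt (mul_le_of_le_one_left (norm_nonneg _) hs.2) hT
    have h2 := isUnit_one_sub_of_norm_lt_one h1
    rw [sub_neg_eq_add] at h2
    have h3 : IsUnit ((1 + s • T : E →L[ℝ] E) : E →ₗ[ℝ] E) :=
      h2.map ContinuousLinearMap.toLinearMapRingHom
    exact (((LinearMap.isUnit_iff_isUnit_det _).1 h3).ne_zero :)
  have hc : Continuous fun s : ℝ => (ContinuousLinearMap.id ℝ E + s • T).det :=
    ContinuousLinearMap.continuous_det.comp (by fun_prop)
  by_contra! hneg
  obtain ⟨s, hs, h0⟩ := intermediate_value_Icc' zero_le_one hc.continuousOn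
    (show (0 : ℝ) ∈ Set.Icc _ _ from ⟨by simpa using hneg, by simp [ContinuousLinearMap.det]⟩)
  exact hne s hs h0

theorem bijective_id_add_of_lipschitzWith {E : Type*} [NormedAddCommGroup E] [CompleteSpace E]
    {K : NNReal} {h : E → E} (hK : K < 1) (hh : LipschitzWith K h) :
    Function.Bijective fun x => x + h x := by
  constructor
  · intro x y hxy
    have h1 : x - y = h y - h x := by
      have : x + h x = y + h y := hxy
      rw [sub_eq_sub_iff_add_eq_add, this, add_comm]
    have h2 := hh.dist_le_mul y x
    rw [dist_eq_norm, dist_eq_norm, ← h1, norm_sub_rev y x] at h2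
    by_contra hne
    have : 0 < ‖x - y‖ := norm_pos_iff.2 (sub_ne_zero.2 hne)
    have hK' : (K : ℝ) < 1 := hK
    nlinarith
  · intro y
    have hc : ContractingWith K fun x => y - h x := by
      refine ⟨hK, LipschitzWith.of_dist_le_mul fun a b => ?_⟩
      rw [dist_sub_left]
      exact hh.dist_le_mul a b
    exact ⟨hc.fixedPoint, by
      have := hc.fixedPoint_isFixedPt
      rw [Function.IsFixedPt, sub_eq_iff_eq_add] at this
      exact this.symm⟩

theorem image_ball_id_add {E : Type*} [NormedAddCommGroup E] [CompleteSpace E]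
    {K : NNReal} {h : E → E} (hK : K < 1) (hh : LipschitzWith K h)
    (h0 : ∀ x, x ∉ Metric.ball (0 : E) 1 → h x = 0) :
    (fun x => x + h x) '' Metric.ball (0 : E) 1 = Metric.ball (0 : E) 1 := by
  obtain ⟨hinj, hsurj⟩ := bijective_id_add_of_lipschitzWith hK hh
  ext y
  constructor
  · rintro ⟨x, hx, rfl⟩
    by_contra hy
    have : x + h x = x :=
      hinj (show (x + h x) + h (x + h x) = x + h x by rw [h0 _ hy, add_zero])
    exact hy (by simpa only [this] using hx)
  · intro hy
    obtain ⟨x, rfl⟩ := hsurj y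
    refine ⟨x, ?_, rfl⟩
    by_contra hx
    exact hx (by simpa [h0 x hx] using hy)

theorem exists_mem_segment_norm_eq {E : Type*} [NormedAddCommGroup E] [NormedSpace ℝ E]
    {x y : E} {r : ℝ} (hx : ‖x‖ ≤ r) (hy : r ≤ ‖y‖) : ∃ z, ‖z‖ = r ∧ ‖x - z‖ ≤ ‖x - y‖ := by
  have hc : Continuous fun t : ℝ => ‖AffineMap.lineMap x y t‖ := by
    simp only [AffineMap.lineMap_apply]; fun_prop
  obtain ⟨t, ht, h⟩ := intermediate_value_Icc zero_le_one hc.continuousOn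
    (show r ∈ Set.Icc _ _ by simpa using ⟨hx, hy⟩)
  refine ⟨_, h, ?_⟩
  rw [← dist_eq_norm, dist_left_lineMap, dist_eq_norm, Real.norm_of_nonneg ht.1]
  exact mul_le_of_le_one_left (norm_nonneg _) ht.2

theorem LipschitzOnWith.indicator_ball {E : Type*} [NormedAddCommGroup E] [NormedSpace ℝ E]
    {K : NNReal} {g : E → E} (hg : LipschitzOnWith K g (Metric.closedBall 0 1))
    (h0 : ∀ x, ‖x‖ = 1 → g x = 0) : LipschitzWith K ((Metric.ball (0 : E) 1).indicator g) := by
  classical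
  have key : ∀ x y : E, x ∈ Metric.ball (0 : E) 1 → y ∉ Metric.ball (0 : E) 1 →
      ‖g x‖ ≤ K * ‖x - y‖ := by
    intro x y hx hy
    rw [mem_ball_zero_iff] at hx hy
    obtain ⟨z, hz, hzy⟩ := exists_mem_segment_norm_eq hx.le (not_lt.1 hy)
    have := hg.norm_sub_le (show x ∈ _ by simpa using hx.le) (show z ∈ _ by simpa using hz.le)
    rw [h0 z hz, sub_zero] at this
    exact this.trans (by gcongr)
  refine LipschitzWith.of_dist_le_mul fun x y => ?_
  rw [dist_eq_norm, dist_eq_norm]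
  by_cases hx : x ∈ Metric.ball (0 : E) 1 <;> by_cases hy : y ∈ Metric.ball (0 : E) 1
  · simpa [hx, hy] using hg.norm_sub_le (Metric.ball_subset_closedBall hx)
      (Metric.ball_subset_closedBall hy)
  · rw [Set.indicator_of_mem hx, Set.indicator_of_notMem hy, sub_zero]
    exact key x y hx hy
  · rw [Set.indicator_of_notMem hx, Set.indicator_of_mem hy, zero_sub, norm_neg, norm_sub_rev]
    exact key y x hy hx
  · rw [Set.indicator_of_notMem hx, Set.indicator_of_notMem hy, sub_zero, norm_zero]
    positivity

open MeasureTheory in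
theorem not_exists_contDiffOn_retraction {E : Type*} [NormedAddCommGroup E]
    [InnerProductSpace ℝ E] [FiniteDimensional ℝ E] {U : Set E} (hU : IsOpen U)
    (hBU : Metric.closedBall (0 : E) 1 ⊆ U) {r : E → E} (hr : ContDiffOn ℝ 1 r U)
    (hnorm : ∀ x ∈ Metric.closedBall (0 : E) 1, ‖r x‖ = 1) :
    ¬ ∀ x : E, ‖x‖ = 1 → r x = x := by
  intro hfix
  let _ : MeasurableSpace E := borel E
  have : BorelSpace E := ⟨rfl⟩
  have hcE : CompleteSpace E := FiniteDimensional.complete ℝ E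
  let B := Metric.ball (0 : E) 1
  let g : E → E := fun x => r x - x
  have hg : ContDiffOn ℝ 1 g U := hr.sub contDiffOn_id
  have hcomp : IsCompact (Metric.closedBall (0 : E) 1) := isCompact_closedBall _ _
  obtain ⟨K, hK⟩ := (hg.mono hBU).exists_lipschitzOnWith one_ne_zero (convex_closedBall _ _) hcomp
  have hfd : ContinuousOn (fderiv ℝ g) U := hg.continuousOn_fderiv_of_isOpen hU le_rfl
  have hKd : ∀ x ∈ B, ‖fderiv ℝ g x‖ ≤ K := fun x hx =>
    norm_fderiv_le_of_lipschitzOn ℝ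
      (Filter.mem_of_superset (Metric.isOpen_ball.mem_nhds hx) Metric.ball_subset_closedBall) hK
  have hgd : ∀ x ∈ B, HasFDerivAt g (fderiv ℝ g x) x := fun x hx =>
    ((hg.differentiableOn one_ne_zero).differentiableAt
      (hU.mem_nhds (hBU (Metric.ball_subset_closedBall hx)))).hasFDerivAt
  have hg0 : ∀ x : E, ‖x‖ = 1 → g x = 0 := fun x hx => sub_eq_zero.2 (hfix x hx)
  have hlip := hK.indicator_ball hg0
  let δ : ℝ := 1 / (K + 2)
  have hδ : 0 < δ := by positivity
  let V : ℝ := volume.real B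
  have hV : 0 < V := by
    refine ENNReal.toReal_pos (Metric.measure_ball_pos volume _ one_pos).ne' measure_ball_lt_top.ne
  let D : ℝ → E → ℝ := fun t x => (ContinuousLinearMap.id ℝ E + t • fderiv ℝ g x).det
  have hDint : ∀ t, IntegrableOn (D t) B volume := by
    intro t
    have : ContinuousOn (D t) (Metric.closedBall (0 : E) 1) :=
      ContinuousLinearMap.continuous_det.comp_continuousOn
        (continuousOn_const.add ((hfd.mono hBU).const_smul t))
    exact (this.integrableOn_compact hcomp).mono_set Metric.ball_subset_closedBall
  have hDV : ∀ t, 0 ≤ t → t ≤ δ → ∫ x in B, D t x = V := by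
    intro t ht0 htδ
    have htK : t * K < 1 := by
      have h1 : t * K ≤ δ * K := by gcongr
      have h2 : δ * K < 1 := by
        simp only [δ]; rw [div_mul_eq_mul_div, div_lt_one (by positivity)]; linarith
      linarith
    let h : E → E := fun x => t • B.indicator g x
    have hh : LipschitzWith (t.toNNReal * K) h := by
      refine LipschitzWith.of_dist_le_mul fun x y => ?_
      rw [dist_eq_norm, ← smul_sub, norm_smul, Real.norm_of_nonneg ht0, ← dist_eq_norm,
        NNReal.coe_mul, Real.coe_toNNReal t ht0, mul_assoc]
      exact mul_le_mul_of_nonneg_left (hlip.dist_le_mul x y) ht0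
    have hK1 : t.toNNReal * K < 1 := by
      rw [← NNReal.coe_lt_coe, NNReal.coe_mul, Real.coe_toNNReal t ht0]
      exact htK
    have himg := image_ball_id_add hK1 hh fun x hx => by simp [h, B, Set.indicator_of_notMem hx]
    have hinj := (bijective_id_add_of_lipschitzWith hK1 hh).1
    have hder : ∀ x ∈ B, HasFDerivWithinAt (fun x => x + h x)
        (ContinuousLinearMap.id ℝ E + t • fderiv ℝ g x) B x := by
      intro x hx
      have h1 : HasFDerivAt (fun x => x + t • g x)
          (ContinuousLinearMap.id ℝ E + t • fderiv ℝ g x) x :=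
        (hasFDerivAt_id x).add ((hgd x hx).const_smul t)
      exact h1.hasFDerivWithinAt.congr (fun y hy => by simp [h, Set.indicator_of_mem hy])
        (by simp [h, Set.indicator_of_mem hx])
    have hcv := integral_image_eq_integral_abs_det_fderiv_smul volume
      (Metric.isOpen_ball.measurableSet) hder hinj.injOn (fun _ => (1 : ℝ))
    rw [himg] at hcv
    simp only [smul_eq_mul, mul_one, setIntegral_const] at hcv
    rw [show V = volume.real B from rfl, hcv]
    refine setIntegral_congr_fun Metric.isOpen_ball.measurableSet fun x hx => ?_
    refine (abs_of_pos (ContinuousLinearMap.det_id_add_pos ?_)).symm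
    rw [norm_smul, Real.norm_of_nonneg ht0]
    exact lt_of_le_of_lt (mul_le_mul_of_nonneg_left (hKd x hx) ht0) htK
  obtain ⟨t, w, ht, hw⟩ := exists_extrapolation_weights (Module.finrank ℝ E) hδ
  have hD1 : ∀ x ∈ B, D 1 x = 0 := by
    intro x hx
    have hrd : HasFDerivAt r (ContinuousLinearMap.id ℝ E + (1 : ℝ) • fderiv ℝ g x) x := by
      have := (hasFDerivAt_id x).add (hgd x hx)
      rw [one_smul]
      convert this using 1
      ext y
      simp [g]
    set T := ContinuousLinearMap.id ℝ E + (1 : ℝ) • fderiv ℝ g x with hT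
    have hin := hrd.inner ℝ hrd
    have hconst : (fun y => inner ℝ (r y) (r y)) =ᶠ[𝓝 x] fun _ => (1 : ℝ) := by
      filter_upwards [Metric.isOpen_ball.mem_nhds hx] with y hy
      rw [real_inner_self_eq_norm_sq, hnorm y (Metric.ball_subset_closedBall hy), one_pow]
    have hz := hin.unique ((hasFDerivAt_const (1 : ℝ) x).congr_of_eventuallyEq hconst)
    have horth : ∀ v, inner ℝ (r x) (T v) = 0 := by
      intro v
      have h2 := congrArg (fun L : E →L[ℝ] ℝ => L v) hz
      simp [fderivInnerCLM_apply] at h2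
      rw [real_inner_comm (r x)] at h2
      linarith
    by_contra hne
    let e := LinearMap.equivOfDetNeZero (T : E →ₗ[ℝ] E) hne
    have h3 := horth (e.symm (r x))
    have h4 : T (e.symm (r x)) = r x := e.apply_symm_apply (r x)
    rw [h4, real_inner_self_eq_norm_sq, hnorm x (Metric.ball_subset_closedBall hx)] at h3
    norm_num at h3
  have hexp : ∀ x, D 1 x = ∑ i, w i * D (t i) x := by
    intro x
    obtain ⟨p, hp, hpe⟩ := exists_polynomial_det_one_add_smul (fderiv ℝ g x)
    simp only [D, hpe]
    exact hw p hp
  have hsum : ∑ i, w i = 1 := by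
    simpa using (hw 1 (by simp)).symm
  have hfin : ∫ x in B, D 1 x = V := by
    simp_rw [hexp]
    rw [integral_finsetSum _ fun i _ => (hDint (t i)).const_mul _]
    simp_rw [integral_const_mul]
    rw [Finset.sum_congr rfl fun i _ => by rw [hDV _ (ht i).1 (ht i).2], ← Finset.sum_mul, hsum,
      one_mul]
  rw [setIntegral_congr_fun Metric.isOpen_ball.measurableSet hD1] at hfin
  simp at hfin
  exact hV.ne hfin

theorem exists_fixedPoint_of_contDiff {E : Type*} [NormedAddCommGroup E]
    [InnerProductSpace ℝ E] [FiniteDimensional ℝ E] {f : E → E} (hf : ContDiff ℝ 1 f)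
    (hmaps : Set.MapsTo f (Metric.closedBall (0 : E) 1) (Metric.closedBall (0 : E) 1)) :
    ∃ x ∈ Metric.closedBall (0 : E) 1, f x = x := by
  by_contra! hno
  let u : E → E := fun x => x - f x
  let d : E → ℝ := fun x => inner ℝ x (u x) ^ 2 + ‖u x‖ ^ 2 * (1 - ‖x‖ ^ 2)
  let l : E → ℝ := fun x => (-inner ℝ x (u x) + Real.sqrt (d x)) / ‖u x‖ ^ 2
  let r : E → E := fun x => x + l x • u x
  have hu : ContDiff ℝ 1 u := contDiff_id.sub hf
  have hd : ContDiff ℝ 1 d :=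
    ((contDiff_id.inner ℝ hu).pow 2).add
      ((hu.norm_sq ℝ).mul (contDiff_const.sub (contDiff_id.norm_sq ℝ)))
  let U : Set E := {x | u x ≠ 0} ∩ {x | 0 < d x}
  have hU : IsOpen U :=
    (isOpen_ne_fun hu.continuous continuous_const).inter
      (isOpen_lt continuous_const hd.continuous)
  have hu0 : ∀ x ∈ Metric.closedBall (0 : E) 1, u x ≠ 0 := fun x hx h =>
    hno x hx (sub_eq_zero.1 h).symm
  have hinner : ∀ x : E, ‖x‖ = 1 → 0 < inner ℝ x (u x) := by
    intro x hx
    have hxB : x ∈ Metric.closedBall (0 : E) 1 := by simp [hx]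
    have hfx : ‖f x‖ ≤ 1 := by simpa using hmaps hxB
    have h1 : ‖u x‖ ^ 2 = ‖x‖ ^ 2 - 2 * inner ℝ x (f x) + ‖f x‖ ^ 2 := norm_sub_sq_real _ _
    have h2 : inner ℝ x (u x) = ‖x‖ ^ 2 - inner ℝ x (f x) := by
      simp only [u]; rw [inner_sub_right, real_inner_self_eq_norm_sq]
    have h3 : 0 < ‖u x‖ := norm_pos_iff.2 (hu0 x hxB)
    have h4 := norm_nonneg (f x)
    rw [hx] at h1 h2
    nlinarith
  have hBU : Metric.closedBall (0 : E) 1 ⊆ U := by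
    intro x hx
    refine ⟨hu0 x hx, ?_⟩
    have hx1 : ‖x‖ ≤ 1 := by simpa using hx
    have h3 : 0 < ‖u x‖ := norm_pos_iff.2 (hu0 x hx)
    change 0 < inner ℝ x (u x) ^ 2 + ‖u x‖ ^ 2 * (1 - ‖x‖ ^ 2)
    rcases hx1.lt_or_eq with h | h
    · have : 0 < 1 - ‖x‖ ^ 2 := by nlinarith [norm_nonneg x]
      positivity
    · have := hinner x h
      rw [h]
      positivity
  have hr : ContDiffOn ℝ 1 r U := by
    have hl : ContDiffOn ℝ 1 l U :=
      ((contDiff_id.inner ℝ hu).neg.contDiffOn.add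
        (hd.contDiffOn.sqrt fun x hx => hx.2.ne')).div (hu.norm_sq ℝ).contDiffOn
        fun x hx => pow_ne_zero 2 (norm_ne_zero_iff.2 hx.1)
    exact contDiffOn_id.add (hl.smul hu.contDiffOn)
  refine not_exists_contDiffOn_retraction hU hBU hr ?_ ?_
  · intro x hx
    have h3 : ‖u x‖ ^ 2 ≠ 0 := pow_ne_zero 2 (norm_ne_zero_iff.2 (hu0 x hx))
    have h4 : Real.sqrt (d x) ^ 2 = d x := Real.sq_sqrt (hBU hx).2.le
    have h5 : l x * ‖u x‖ ^ 2 = -inner ℝ x (u x) + Real.sqrt (d x) := div_mul_cancel₀ _ h3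
    have h6 : ‖r x‖ ^ 2 = 1 := by
      have : ‖r x‖ ^ 2 = ‖x‖ ^ 2 + 2 * inner ℝ x (l x • u x) + ‖l x • u x‖ ^ 2 :=
        norm_add_sq_real _ _
      rw [this, inner_smul_right, norm_smul, mul_pow, Real.norm_eq_abs, sq_abs]
      have h7 : d x = inner ℝ x (u x) ^ 2 + ‖u x‖ ^ 2 * (1 - ‖x‖ ^ 2) := rfl
      refine mul_left_cancel₀ h3 ?_
      have h8 : Real.sqrt (d x) = l x * ‖u x‖ ^ 2 + inner ℝ x (u x) := by linarith
      rw [h8] at h4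
      linear_combination h4 + h7
    exact (sq_eq_sq₀ (norm_nonneg _) zero_le_one).1 (by rw [h6, one_pow])
  · intro x hx
    have h1 : d x = inner ℝ x (u x) ^ 2 := by simp [d, hx]
    have h2 : l x = 0 := by
      simp only [l]; rw [h1, Real.sqrt_sq (hinner x hx).le]; simp
    simp [r, h2]

/-- **Brouwer's fixed point theorem** for the closed unit ball of a Euclidean space. -/
theorem brouwer_closedBall {E : Type*} [NormedAddCommGroup E]
    [InnerProductSpace ℝ E] [FiniteDimensional ℝ E] {f : E → E} (hf : Continuous f)
    (hmaps : Set.MapsTo f (Metric.closedBall (0 : E) 1) (Metric.closedBall (0 : E) 1)) :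
    ∃ x ∈ Metric.closedBall (0 : E) 1, f x = x := by
  by_contra! hno
  have hcomp : IsCompact (Metric.closedBall (0 : E) 1) := isCompact_closedBall _ _
  obtain ⟨x₀, hx₀, hmin⟩ := hcomp.exists_isMinOn (Metric.nonempty_closedBall.2 zero_le_one)
    (f := fun x => ‖f x - x‖) (by fun_prop)
  let ε := ‖f x₀ - x₀‖
  have hε : 0 < ε := norm_pos_iff.2 (sub_ne_zero.2 (hno x₀ hx₀))
  obtain ⟨p, hp, hpf, -⟩ := hf.exists_contDiff_approx (ε := fun _ => ε / 2) 1 continuous_const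
    fun _ => by positivity
  let k : ℝ := 1 + ε / 2
  have hk : 0 < k := by positivity
  let q : E → E := fun x => k⁻¹ • p x
  have hpq : ∀ x, p x = k • q x := fun x => by simp [q, smul_smul, hk.ne']
  have hqB : ∀ x ∈ Metric.closedBall (0 : E) 1, ‖q x‖ ≤ 1 := by
    intro x hx
    have h1 : ‖f x‖ ≤ 1 := by simpa using hmaps hx
    have h2 := hpf x
    rw [dist_eq_norm] at h2
    have h3 : ‖p x‖ ≤ ‖f x‖ + ‖p x - f x‖ := norm_le_norm_add_norm_sub' _ _
    rw [norm_smul, Real.norm_of_nonneg (by positivity), inv_mul_le_iff₀ hk]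
    simp only [k]; linarith
  obtain ⟨x, hx, hqx⟩ := exists_fixedPoint_of_contDiff (f := q) (hp.const_smul _)
    fun x hx => by simpa using hqB x hx
  have h1 : ε ≤ ‖f x - x‖ := hmin hx
  have h2 := hpf x
  rw [dist_eq_norm, hpq, hqx] at h2
  have h3 : f x - x = -(k • x - f x) + (ε / 2) • x := by simp only [k]; module
  have h4 : ‖f x - x‖ ≤ ‖k • x - f x‖ + ‖(ε / 2) • x‖ := by
    rw [h3]; exact (norm_add_le _ _).trans (by rw [norm_neg])
  rw [norm_smul, Real.norm_of_nonneg (by positivity)] at h4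
  have h5 : ‖x‖ ≤ 1 := by simpa using hx
  nlinarith

/-- **Brouwer's fixed point theorem** for the standard simplex. -/
theorem brouwer_stdSimplex {ι : Type*} [Fintype ι] [Nonempty ι] {f : (ι → ℝ) → ι → ℝ}
    (hf : ContinuousOn f (stdSimplex ℝ ι))
    (hmaps : Set.MapsTo f (stdSimplex ℝ ι) (stdSimplex ℝ ι)) :
    ∃ x ∈ stdSimplex ℝ ι, f x = x := by
  let s : (ι → ℝ) → ℝ := fun x => ∑ i, max (x i) 0
  let ρ : (ι → ℝ) → ι → ℝ := fun x i =>
    (max (x i) 0 + max (1 - s x) 0 / Fintype.card ι) / max (s x) 1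
  have hs : Continuous s := by fun_prop
  have hpos : ∀ x, 0 < max (s x) 1 := fun x => lt_max_of_lt_right one_pos
  have hρ : Continuous ρ := by
    refine continuous_pi fun i => ?_
    exact Continuous.div (by fun_prop) (by fun_prop) fun x => (hpos x).ne'
  have hρm : ∀ x, ρ x ∈ stdSimplex ℝ ι := by
    intro x
    refine ⟨fun i => div_nonneg (by positivity) (hpos x).le, ?_⟩
    simp only [ρ]
    rw [← Finset.sum_div, div_eq_one_iff_eq (hpos x).ne', Finset.sum_add_distrib, Finset.sum_const,
      Finset.card_univ, nsmul_eq_mul, mul_div_cancel₀ _ (by simp)]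
    change s x + _ = _
    rcases le_total (s x) 1 with h | h
    · rw [max_eq_left (by linarith), max_eq_right h]; ring
    · rw [max_eq_right (by linarith), max_eq_left h]; ring
  have hρf : ∀ x ∈ stdSimplex ℝ ι, ρ x = x := by
    intro x hx
    have h1 : s x = 1 := by
      rw [← hx.2]; exact Finset.sum_congr rfl fun i _ => max_eq_left (hx.1 i)
    ext i
    simp [ρ, h1, hx.1 i]
  let E := EuclideanSpace ℝ ι
  let F : E → E := fun x => WithLp.toLp 2 (f (ρ x.ofLp))
  have hF : Continuous F := by
    refine (PiLp.continuous_toLp 2 _).comp ?_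
    exact hf.comp_continuous (hρ.comp (PiLp.continuous_ofLp 2 _)) fun x => hρm _
  have hball : ∀ x ∈ stdSimplex ℝ ι, ‖(WithLp.toLp 2 x : E)‖ ≤ 1 := by
    intro x hx
    rw [EuclideanSpace.norm_eq, Real.sqrt_le_iff, one_pow, ← hx.2]
    refine ⟨by simp [hx.2], ?_⟩
    refine Finset.sum_le_sum fun i _ => ?_
    have h0 := hx.1 i
    have h1 : x i ≤ 1 := by
      rw [← hx.2]; exact Finset.single_le_sum (fun j _ => hx.1 j) (Finset.mem_univ i)
    simp only [Real.norm_eq_abs, sq_abs]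
    nlinarith
  obtain ⟨x, -, hx⟩ := brouwer_closedBall hF fun x _ => by
    simpa using hball _ (hmaps (hρm x.ofLp))
  have hx' : f (ρ x.ofLp) = x.ofLp := congrArg WithLp.ofLp hx
  have hmem : x.ofLp ∈ stdSimplex ℝ ι := hx' ▸ hmaps (hρm x.ofLp)
  exact ⟨_, hmem, by rwa [hρf _ hmem] at hx'⟩

theorem WeakConv.unique {u : ℕ → X} {x y : X} (hx : WeakConv u x) (hy : WeakConv u y) : x = y :=
  (SeparatingDual.eq_iff_forall_dual_eq (R := ℝ)).2 fun f => tendsto_nhds_unique (hx f) (hy f)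

theorem WeakConv.subseq {u : ℕ → X} {x : X} (hx : WeakConv u x) {φ : ℕ → ℕ}
    (hφ : StrictMono φ) : WeakConv (u ∘ φ) x :=
  fun f => (hx f).comp hφ.tendsto_atTop

theorem WeakConv.of_tendsto {u : ℕ → X} {x : X} (hx : Tendsto u atTop (𝓝 x)) : WeakConv u x :=
  fun f => (f.continuous.tendsto x).comp hx

theorem WeakConv.add {u v : ℕ → X} {x y : X} (hx : WeakConv u x) (hy : WeakConv v y) :
    WeakConv (fun n => u n + v n) (x + y) :=
  fun f => by simpa using (hx f).add (hy f)

theorem WeakConv.mem_of_isClosed_of_convex {S : Set X} (hcl : IsClosed S) (hconv : Convex ℝ S)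
    {u : ℕ → X} {x : X} (hu : ∀ n, u n ∈ S) (hx : WeakConv u x) : x ∈ S := by
  by_contra hxS
  obtain ⟨f, c, hfS, hfx⟩ := geometric_hahn_banach_closed_point hconv hcl hxS
  exact absurd (le_of_tendsto' (hx f) fun n => (hfS _ (hu n)).le) (not_le.2 hfx)

/-- Every sequence in `R` has a weakly convergent subsequence. -/
def RelWeaklySeqCompact (R : Set X) : Prop :=
  ∀ u : ℕ → X, (∀ n, u n ∈ R) → ∃ (x : X) (φ : ℕ → ℕ), StrictMono φ ∧ WeakConv (u ∘ φ) x

theorem RelWeaklySeqCompact.mono {R R' : Set X} (hR : RelWeaklySeqCompact R) (h : R' ⊆ R) :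
    RelWeaklySeqCompact R' :=
  fun u hu => hR u fun n => h (hu n)

theorem exists_seq_dual_separating {s : Set X} (hs : TopologicalSpace.IsSeparable s) :
    ∃ F : ℕ → X →L[ℝ] ℝ, ∀ x ∈ closure (Submodule.span ℝ s : Set X),
      ∀ y ∈ closure (Submodule.span ℝ s : Set X), (∀ i, F i x = F i y) → x = y := by
  have hsep : TopologicalSpace.IsSeparable (closure (Submodule.span ℝ s : Set X)) :=
    (hs.span (R := ℝ)).closure
  obtain ⟨c, hc, hcd⟩ := hsep
  have hcne : c.Nonempty := by
    by_contra h
    rw [Set.not_nonempty_iff_eq_empty] at h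
    rw [h, closure_empty] at hcd
    exact hcd (subset_closure (Submodule.zero_mem _))
  obtain ⟨d, rfl⟩ := hc.exists_eq_range hcne
  choose F hF1 hF2 using fun i => exists_dual_vector'' ℝ (d i)
  refine ⟨F, fun x hx y hy hxy => ?_⟩
  have hmem : x - y ∈ closure (Submodule.span ℝ s : Set X) := by
    have : x - y ∈ (Submodule.span ℝ s).topologicalClosure := Submodule.sub_mem _ hx hy
    exact this
  rw [← sub_eq_zero, ← norm_le_zero_iff]
  refine le_of_forall_pos_le_add fun ε hε => ?_
  obtain ⟨_, ⟨i, rfl⟩, hi⟩ := Metric.mem_closure_iff.1 (hcd hmem) (ε / 2) (by positivity)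
  rw [dist_eq_norm] at hi
  have h1 : F i (x - y) = 0 := by rw [map_sub, hxy i, sub_self]
  have h2 : ‖d i‖ ≤ ‖x - y - d i‖ := by
    have h3 : F i (d i) = ‖d i‖ := hF2 i
    have h4 : ‖F i (x - y - d i)‖ ≤ ‖x - y - d i‖ :=
      ((F i).le_opNorm _).trans (mul_le_of_le_one_left (norm_nonneg _) (hF1 i))
    rwa [map_sub, h1, h3, zero_sub, norm_neg, norm_norm] at h4
  have h5 : ‖x - y‖ ≤ ‖d i‖ + ‖x - y - d i‖ := norm_le_norm_add_norm_sub' _ _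
  linarith

theorem continuous_dual_weakSpace (f : X →L[ℝ] ℝ) :
    Continuous fun z : WeakSpace ℝ X => f ((toWeakSpace ℝ X).symm z) :=
  WeakBilin.eval_continuous (topDualPairing ℝ X).flip f

theorem image_toWeakSpace_weakClosure {R : Set X} :
    toWeakSpace ℝ X '' weakClosure R = closure (toWeakSpace ℝ X '' R) :=
  Set.image_preimage_eq _ (toWeakSpace ℝ X).surjective

theorem RelWeaklyCompact.relWeaklySeqCompact {R : Set X} (hR : RelWeaklyCompact R) :
    RelWeaklySeqCompact R := by
  intro u hu
  let Y : Submodule ℝ X := Submodule.span ℝ (Set.range u)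
  obtain ⟨F, hF⟩ := exists_seq_dual_separating (Set.countable_range u).isSeparable
  let Q : Set (WeakSpace ℝ X) :=
    closure (toWeakSpace ℝ X '' R) ∩ toWeakSpace ℝ X '' closure (Y : Set X)
  have hQ : IsCompact Q := by
    have h : IsCompact (closure (toWeakSpace ℝ X '' R)) := by
      rw [← image_toWeakSpace_weakClosure]; exact hR
    refine h.inter_right ?_
    rw [Y.convex.toWeakSpace_closure ℝ]
    exact isClosed_closure
  have huQ : ∀ n, toWeakSpace ℝ X (u n) ∈ Q := fun n =>
    ⟨subset_closure ⟨u n, hu n, rfl⟩, u n, subset_closure (Submodule.subset_span ⟨n, rfl⟩), rfl⟩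
  let G : Q → ℕ → ℝ := fun z i => F i ((toWeakSpace ℝ X).symm z)
  have hGc : Continuous G :=
    continuous_pi fun i => (continuous_dual_weakSpace (F i)).comp continuous_subtype_val
  have hGi : Function.Injective G := by
    rintro ⟨z, hz, z', hz', rfl⟩ ⟨w, hw, w', hw', rfl⟩ h
    have := hF z' hz' w' hw' fun i => congrFun h i
    simp [this]
  have : CompactSpace Q := isCompact_iff_compactSpace.1 hQ
  have hemb : IsClosedEmbedding G := hGc.isClosedEmbedding hGi
  obtain ⟨_, ⟨a, rfl⟩, φ, hφ, hlim⟩ := (isCompact_range hGc).tendsto_subseq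
    (x := fun n => G ⟨_, huQ n⟩) fun n => ⟨_, rfl⟩
  have h1 : Tendsto (fun n => (⟨_, huQ (φ n)⟩ : Q)) atTop (𝓝 a) :=
    hemb.isInducing.tendsto_nhds_iff.2 hlim
  refine ⟨(toWeakSpace ℝ X).symm a, φ, hφ, fun f => ?_⟩
  exact (((continuous_dual_weakSpace f).comp continuous_subtype_val).tendsto a).comp h1

theorem RelWeaklySeqCompact.exists_dual_bound {R : Set X} (hR : RelWeaklySeqCompact R)
    (f : X →L[ℝ] ℝ) : ∃ M, ∀ x ∈ R, ‖f x‖ ≤ M := by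
  by_contra! h
  choose u hu hfu using fun n : ℕ => h n
  obtain ⟨x, φ, hφ, hx⟩ := hR u hu
  refine not_tendsto_nhds_of_tendsto_atTop ?_ _ (hx f).norm
  refine tendsto_atTop_mono (fun n => (hfu (φ n)).le) ?_
  exact tendsto_natCast_atTop_atTop.comp hφ.tendsto_atTop

theorem RelWeaklySeqCompact.exists_norm_bound {R : Set X} (hR : RelWeaklySeqCompact R) :
    ∃ M, ∀ x ∈ R, ‖x‖ ≤ M := by
  obtain ⟨M, hM⟩ := banach_steinhaus
    (g := fun x : R => NormedSpace.inclusionInDoubleDual ℝ X x) fun f => by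
      obtain ⟨M, hM⟩ := hR.exists_dual_bound f
      exact ⟨M, fun x => by simpa using hM x x.2⟩
  exact ⟨M, fun x hx => by
    have := hM ⟨x, hx⟩
    exact ((NormedSpace.inclusionInDoubleDualLi ℝ).norm_map x).symm.trans_le this⟩

theorem exists_isSeparable_invariant {S : Set X} (hne : S.Nonempty) (hcl : IsClosed S)
    (hconv : Convex ℝ S) {N : X → X} (hNS : Set.MapsTo N S S)
    (hN : ∀ (u : ℕ → X) (x : X), (∀ n, u n ∈ S) → x ∈ S →
      WeakConv u x → WeakConv (fun n => N (u n)) (N x)) :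
    ∃ S₀ ⊆ S, S₀.Nonempty ∧ IsClosed S₀ ∧ Convex ℝ S₀ ∧ TopologicalSpace.IsSeparable S₀ ∧
      Set.MapsTo N S₀ S₀ := by
  obtain ⟨x₀, hx₀⟩ := hne
  let step : Set X → Set X := fun A =>
    A ∪ N '' A ∪ ⋃ q ∈ {q : ℚ | 0 < q ∧ q < 1},
      Set.image2 (fun x y => (1 - q : ℝ) • x + (q : ℝ) • y) A A
  let A : ℕ → Set X := fun n => step^[n] {x₀}
  have hA : ∀ n, A (n + 1) = step (A n) := fun n => Function.iterate_succ_apply' _ _ _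
  have hmono : Monotone A := monotone_nat_of_le_succ fun n => by
    rw [hA]; exact fun x hx => Or.inl (Or.inl hx)
  have hcount : ∀ n, (A n).Countable := by
    intro n
    induction n with
    | zero => exact Set.countable_singleton _
    | succ n ih =>
      rw [hA]
      exact (ih.union (ih.image _)).union
        (Set.Countable.biUnion (Set.to_countable _) fun q _ => ih.image2 ih _)
  have hAS : ∀ n, A n ⊆ S := by
    intro n
    induction n with
    | zero => exact Set.singleton_subset_iff.2 hx₀
    | succ n ih =>
      rw [hA]
      refine Set.union_subset (Set.union_subset ih ?_) ?_
      · rintro _ ⟨x, hx, rfl⟩; exact hNS (ih hx)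
      · refine Set.iUnion₂_subset fun q hq => ?_
        rintro _ ⟨x, hx, y, hy, rfl⟩
        have h0 : (0 : ℝ) < q := by exact_mod_cast hq.1
        have h1 : (q : ℝ) < 1 := by exact_mod_cast hq.2
        exact hconv (ih hx) (ih hy) (by linarith) h0.le (by ring)
  let T : Set X := ⋃ n, A n
  have hTS : T ⊆ S := Set.iUnion_subset hAS
  have hTN : ∀ x ∈ T, N x ∈ T := by
    intro x hx
    obtain ⟨n, hn⟩ := Set.mem_iUnion.1 hx
    exact Set.mem_iUnion.2 ⟨n + 1, by rw [hA]; exact Or.inl (Or.inr ⟨x, hn, rfl⟩)⟩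
  have hTm : ∀ q : ℚ, 0 < q ∧ q < 1 → ∀ x ∈ T, ∀ y ∈ T,
      (1 - q : ℝ) • x + (q : ℝ) • y ∈ T := by
    intro q hq x hx y hy
    obtain ⟨n, hn⟩ := Set.mem_iUnion.1 hx
    obtain ⟨m, hm⟩ := Set.mem_iUnion.1 hy
    refine Set.mem_iUnion.2 ⟨max n m + 1, ?_⟩
    rw [hA]
    exact Or.inr (Set.mem_biUnion hq
      ⟨x, hmono (le_max_left _ _) hn, y, hmono (le_max_right _ _) hm, rfl⟩)
  have hconv' : Convex ℝ (closure T) := by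
    refine convex_iff_forall_pos.2 fun x hx y hy a b ha hb hab => ?_
    have hb' : b ∈ Set.Ioo (0 : ℝ) 1 := ⟨hb, by linarith⟩
    have hbc := Rat.denseRange_cast.open_subset_closure_inter isOpen_Ioo hb'
    have hc : Continuous fun c : ℝ => (1 - c) • x + c • y := by fun_prop
    obtain rfl : a = 1 - b := by linarith
    rw [← closure_closure]
    refine map_mem_closure (f := fun c : ℝ => (1 - c) • x + c • y) hc hbc ?_
    rintro _ ⟨hq, q, rfl⟩
    refine map_mem_closure₂ (f := fun x y => (1 - q : ℝ) • x + (q : ℝ) • y) (by fun_prop) hx hy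
      (hTm q ⟨?_, ?_⟩)
    · exact_mod_cast hq.1
    · exact_mod_cast hq.2
  have hcS : closure T ⊆ S := closure_minimal hTS hcl
  refine ⟨closure T, hcS, ⟨x₀, subset_closure (Set.mem_iUnion.2 ⟨0, rfl⟩)⟩, isClosed_closure,
    hconv', (Set.countable_iUnion hcount).isSeparable.closure, ?_⟩
  intro x hx
  obtain ⟨u, hu, hux⟩ := mem_closure_iff_seq_limit.1 hx
  exact (hN u x (fun n => hTS (hu n)) (hcS hx) (.of_tendsto hux)).mem_of_isClosed_of_convex
    isClosed_closure hconv' fun n => subset_closure (hTN _ (hu n))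

theorem exists_mem_convexHull_of_totallyBounded {κ : Type*} [Fintype κ] {S : Set X}
    (hne : S.Nonempty)
    (hconv : Convex ℝ S) {N : X → X} (hNS : Set.MapsTo N S S)
    (hN : ∀ (u : ℕ → X) (x : X), (∀ n, u n ∈ S) → x ∈ S →
      WeakConv u x → WeakConv (fun n => N (u n)) (N x))
    (F : κ → X →L[ℝ] ℝ) (hF : ∀ i, ∃ M, ∀ x ∈ N '' S, ‖F i x‖ ≤ M) {ε : ℝ} (hε : 0 < ε) :
    ∃ x ∈ S, x ∈ convexHull ℝ {w ∈ N '' S | ∀ i, ‖F i w - F i (N x)‖ ≤ ε} := by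
  let Φ : X → κ → ℝ := fun x i => F i x
  have hΦ : TotallyBounded (Φ '' (N '' S)) := by
    choose M hM using hF
    refine (isCompact_univ_pi fun i => isCompact_Icc (a := -M i) (b := M i)).totallyBounded.subset ?_
    rintro _ ⟨x, hx, rfl⟩ i -
    exact abs_le.1 (hM i x hx)
  obtain ⟨t, hts, htf, hcov⟩ := Metric.finite_approx_of_totallyBounded hΦ ε hε
  have := htf.fintype
  choose w hwN hw using fun y : t => hts y.2
  have hwS : ∀ y, w y ∈ S := fun y => by
    obtain ⟨x, hx, h⟩ := hwN y; exact h ▸ hNS hx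
  have hcover : ∀ x ∈ S, ∃ y : t, dist (Φ (N x)) y < ε := by
    intro x hx
    obtain ⟨y, hy, h⟩ := Set.mem_iUnion₂.1 (hcov ⟨N x, ⟨x, hx, rfl⟩, rfl⟩)
    exact ⟨⟨y, hy⟩, h⟩
  obtain ⟨x₀, hx₀⟩ := hne
  have : Nonempty t := ⟨(hcover x₀ hx₀).choose⟩
  let μ : (κ → ℝ) → t → ℝ := fun z y => max 0 (ε - dist z y)
  let σ : (κ → ℝ) → ℝ := fun z => ∑ y, μ z y
  have hμ0 : ∀ z y, 0 ≤ μ z y := fun z y => le_max_left _ _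
  have hμc : Continuous μ := by fun_prop
  have hσc : Continuous σ := by fun_prop
  have hσ : ∀ x ∈ S, 0 < σ (Φ (N x)) := by
    intro x hx
    obtain ⟨y, hy⟩ := hcover x hx
    exact Finset.sum_pos' (fun y _ => hμ0 _ y)
      ⟨y, Finset.mem_univ _, lt_max_of_lt_right (sub_pos.2 hy)⟩
  let L : (t → ℝ) → X := fun a => ∑ y, a y • w y
  have hLc : Continuous L := by fun_prop
  have hLS : ∀ a ∈ stdSimplex ℝ t, L a ∈ S := fun a ha =>
    hconv.sum_mem (fun y _ => ha.1 y) ha.2 fun y _ => hwS y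
  let f : (t → ℝ) → t → ℝ := fun a y => μ (Φ (N (L a))) y / σ (Φ (N (L a)))
  have hcont : ContinuousOn (fun a => Φ (N (L a))) (stdSimplex ℝ t) := by
    rw [continuousOn_iff_continuous_domRestrict]
    refine SeqContinuous.continuous fun u a hu => tendsto_pi_nhds.2 fun i => ?_
    exact hN _ _ (fun n => hLS _ (u n).2) (hLS _ a.2) (.of_tendsto
      (((hLc.comp continuous_subtype_val).tendsto a).comp hu)) (F i)
  obtain ⟨a, ha, hfa⟩ := brouwer_stdSimplex (f := f)
    (continuousOn_pi.2 fun y => ((continuous_apply y).comp_continuousOn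
      (hμc.comp_continuousOn hcont)).div (hσc.comp_continuousOn hcont)
        fun a ha => (hσ _ (hLS a ha)).ne')
    (fun a ha => ⟨fun y => div_nonneg (hμ0 _ _) (hσ _ (hLS a ha)).le, by
      simp only [f]
      rw [← Finset.sum_div]
      exact div_self (hσ _ (hLS a ha)).ne'⟩)
  refine ⟨L a, hLS a ha, ?_⟩
  have hLa : L a = ∑ y ∈ Finset.univ.filter (fun y => a y ≠ 0), a y • w y := by
    refine (Finset.sum_filter_of_ne fun y _ h => ?_).symm
    exact fun h0 => h (by rw [h0, zero_smul])
  suffices h : ∑ y ∈ Finset.univ.filter (fun y => a y ≠ 0), a y • w y ∈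
      convexHull ℝ {v ∈ N '' S | ∀ i, ‖F i v - F i (N (L a))‖ ≤ ε} by rwa [← hLa] at h
  refine (convex_convexHull ℝ _).sum_mem (fun y _ => ha.1 y) ?_ fun y hy => ?_
  · rw [Finset.sum_filter_ne_zero, ha.2]
  · refine subset_convexHull ℝ _ ⟨hwN y, fun i => ?_⟩
    have h1 : μ (Φ (N (L a))) y ≠ 0 := by
      intro h
      refine (Finset.mem_filter.1 hy).2 ?_
      rw [← hfa]
      simp only [f, h, zero_div]
    have h2 : dist (Φ (N (L a))) y < ε := by
      by_contra! h
      exact h1 (max_eq_left (sub_nonpos.2 h))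
    rw [← hw y, dist_comm] at h2
    have h3 := (dist_le_pi_dist (Φ (w y)) (Φ (N (L a))) i).trans h2.le
    rwa [dist_eq_norm] at h3

theorem RelWeaklySeqCompact.exists_dual_modulus {R : Set X} (hR : RelWeaklySeqCompact R)
    {F : ℕ → X →L[ℝ] ℝ} {Y : Set X} (hRY : ∀ u : ℕ → X, (∀ n, u n ∈ R) →
      ∀ x, WeakConv u x → x ∈ Y)
    (hF : ∀ x ∈ Y, ∀ y ∈ Y, (∀ i, F i x = F i y) → x = y) (f : X →L[ℝ] ℝ) {ε : ℝ} (hε : 0 < ε) :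
    ∃ n : ℕ, ∀ x ∈ R, ∀ y ∈ R, (∀ i ≤ n, ‖F i x - F i y‖ ≤ 1 / ((n : ℝ) + 1)) →
      ‖f x - f y‖ ≤ ε := by
  by_contra! h
  choose u hu v hv huv hf using h
  obtain ⟨x, φ, hφ, hx⟩ := hR u hu
  obtain ⟨y, ψ, hψ, hy⟩ := hR (v ∘ φ) fun n => hv _
  have hx' := hx.subseq hψ
  have hφψ : Tendsto (φ ∘ ψ) atTop atTop := (hφ.comp hψ).tendsto_atTop
  have hxy : x = y := by
    refine hF x (hRY _ (fun n => hu _) x hx') y (hRY _ (fun n => hv _) y hy) fun i => ?_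
    have h1 := ((hx' (F i)).sub (hy (F i))).norm
    have h2 : Tendsto (fun n => 1 / (((φ ∘ ψ) n : ℝ) + 1)) atTop (𝓝 0) :=
      tendsto_one_div_add_atTop_nhds_zero_nat.comp hφψ
    have h3 : ‖F i x - F i y‖ ≤ 0 := by
      refine le_of_tendsto_of_tendsto h1 h2 ?_
      filter_upwards [hφψ.eventually_ge_atTop i] with n hn
      exact huv _ i hn
    exact sub_eq_zero.1 (norm_le_zero_iff.1 h3)
  subst hxy
  have h4 := ((hx' f).sub (hy f)).norm
  rw [sub_self, norm_zero] at h4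
  exact absurd (ge_of_tendsto' h4 fun n => (hf _).le) (not_le.2 hε)

/-- A weakly sequentially continuous self-map of a nonempty closed convex set whose range is
relatively weakly sequentially compact has a fixed point. -/
theorem exists_fixedPoint_of_relWeaklySeqCompact {S : Set X} (hne : S.Nonempty)
    (hcl : IsClosed S) (hconv : Convex ℝ S) {N : X → X} (hNS : Set.MapsTo N S S)
    (hN : ∀ (u : ℕ → X) (x : X), (∀ n, u n ∈ S) → x ∈ S →
      WeakConv u x → WeakConv (fun n => N (u n)) (N x))
    (hcomp : RelWeaklySeqCompact (N '' S)) : ∃ x ∈ S, N x = x := by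
  obtain ⟨S₀, hS₀S, hne₀, hcl₀, hconv₀, hsep, hNS₀⟩ :=
    exists_isSeparable_invariant hne hcl hconv hNS hN
  replace hN : ∀ (u : ℕ → X) (x : X), (∀ n, u n ∈ S₀) → x ∈ S₀ →
      WeakConv u x → WeakConv (fun n => N (u n)) (N x) :=
    fun u x hu hx => hN u x (fun n => hS₀S (hu n)) (hS₀S hx)
  replace hcomp : RelWeaklySeqCompact (N '' S₀) := hcomp.mono (Set.image_mono hS₀S)
  obtain ⟨F, hF⟩ := exists_seq_dual_separating hsep
  have hS₀cl : S₀ ⊆ closure (Submodule.span ℝ S₀ : Set X) :=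
    Submodule.subset_span.trans subset_closure
  have hsub : N '' S₀ ⊆ S₀ := hNS₀.image_subset
  choose x hxS hx using fun n : ℕ => exists_mem_convexHull_of_totallyBounded hne₀ hconv₀ hNS₀ hN
    (fun i : Fin (n + 1) => F i) (fun i => hcomp.exists_dual_bound _)
    (show (0 : ℝ) < 1 / ((n : ℝ) + 1) by positivity)
  obtain ⟨z, φ, hφ, hz⟩ := hcomp (fun n => N (x n)) fun n => ⟨_, hxS n, rfl⟩
  have hzS : z ∈ S₀ := hz.mem_of_isClosed_of_convex hcl₀ hconv₀ fun n => hNS₀ (hxS _)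
  have hclose : ∀ f : X →L[ℝ] ℝ, Tendsto (fun n => f (x n) - f (N (x n))) atTop (𝓝 0) := by
    intro f
    rw [Metric.tendsto_atTop]
    intro ε hε
    obtain ⟨n₀, hn₀⟩ := hcomp.exists_dual_modulus (F := F) (Y := S₀)
      (fun u hu y hy => hy.mem_of_isClosed_of_convex hcl₀ hconv₀ fun n => hsub (hu n))
      (fun a ha b hb => hF a (hS₀cl ha) b (hS₀cl hb)) f (half_pos hε)
    refine ⟨n₀, fun n hn => ?_⟩
    rw [dist_zero_right]
    refine lt_of_le_of_lt ?_ (half_lt_self hε)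
    have hball : convexHull ℝ {w ∈ N '' S₀ | ∀ i : Fin (n + 1),
        ‖F i w - F i (N (x n))‖ ≤ 1 / ((n : ℝ) + 1)} ⊆
        f ⁻¹' Metric.closedBall (f (N (x n))) (ε / 2) := by
      refine convexHull_min ?_ ((convex_closedBall _ _).is_linear_preimage f.toLinearMap.isLinear)
      rintro w ⟨hwN, hw⟩
      rw [Set.mem_preimage, mem_closedBall_iff_norm]
      refine hn₀ w hwN _ ⟨_, hxS n, rfl⟩ fun i hi => ?_
      refine (hw ⟨i, by omega⟩).trans ?_
      exact one_div_le_one_div_of_le (by positivity) (by gcongr)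
    exact mem_closedBall_iff_norm.1 (hball (hx n))
  have hxz : WeakConv (x ∘ φ) z := fun f => by
    have h := ((hclose f).comp hφ.tendsto_atTop).add (hz f)
    simpa using h
  exact ⟨z, hS₀S hzS, (hN _ z (fun n => hxS _) hzS hxz).unique hz⟩

/-- hybrid fixed point theorem for `x = A x · B x + C x` in a real Banach
algebra with identity satisfying condition (P), where `A(S)`, `B(S)` and `C(S)`
are relatively weakly compact. -/
theorem hybrid_fixedPoint_of_relWeaklyCompact_images {X : Type*} [NormedRing X]
    [NormedAlgebra ℝ X] [CompleteSpace X] (hP : CondP X)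
    (S : Set X) (hne : S.Nonempty) (hcl : IsClosed S) (hconv : Convex ℝ S)
    (A B C : X → X)
    (hAwsc : ∀ (u : ℕ → X) (x : X), WeakConv u x → WeakConv (fun n => A (u n)) (A x))
    (hCwsc : ∀ (u : ℕ → X) (x : X), WeakConv u x → WeakConv (fun n => C (u n)) (C x))
    (hBwsc : ∀ (u : ℕ → X) (x : X), (∀ n, u n ∈ S) → x ∈ S →
      WeakConv u x → WeakConv (fun n => B (u n)) (B x))
    (a c : ℝ) (ha0 : 0 ≤ a) (hc0 : 0 ≤ c)
    (hAlip : ∀ x y : X, ‖A x - A y‖ ≤ a * ‖x - y‖)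
    (hClip : ∀ x y : X, ‖C x - C y‖ ≤ c * ‖x - y‖)
    (hAreg : ∀ x : X, IsUnit (A x))
    (hAcomp : RelWeaklyCompact (A '' S))
    (hBcomp : RelWeaklyCompact (B '' S))
    (hCcomp : RelWeaklyCompact (C '' S))
    (hclosure : ∀ x y : X, y ∈ S → x = A x * B y + C x → x ∈ S)
    (hcontr : sSup ((fun y => ‖B y‖) '' S) * a + c < 1) :
    ∃ x ∈ S, x = A x * B x + C x := by
  have hA := hAcomp.relWeaklySeqCompact
  have hB := hBcomp.relWeaklySeqCompact
  have hC := hCcomp.relWeaklySeqCompact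
  set β := sSup ((fun y => ‖B y‖) '' S) with hβ
  have hBβ : ∀ y ∈ S, ‖B y‖ ≤ β := by
    obtain ⟨M, hM⟩ := hB.exists_norm_bound
    refine fun y hy => le_csSup ⟨M, ?_⟩ ⟨y, hy, rfl⟩
    rintro _ ⟨z, hz, rfl⟩
    exact hM _ ⟨z, hz, rfl⟩
  have hβ0 : 0 ≤ β := by
    obtain ⟨y, hy⟩ := hne
    exact (norm_nonneg _).trans (hBβ y hy)
  have hlip : ∀ y ∈ S, ∀ x z : X,
      ‖(A x * B y + C x) - (A z * B y + C z)‖ ≤ (β * a + c) * ‖x - z‖ := by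
    intro y hy x z
    calc ‖(A x * B y + C x) - (A z * B y + C z)‖
        = ‖(A x - A z) * B y + (C x - C z)‖ := by rw [sub_mul]; congr 1; abel
      _ ≤ ‖A x - A z‖ * ‖B y‖ + ‖C x - C z‖ :=
        (norm_add_le _ _).trans (add_le_add_left (norm_mul_le _ _) _)
      _ ≤ (a * ‖x - z‖) * β + c * ‖x - z‖ := by
        gcongr
        exacts [hAlip x z, hBβ y hy, hClip x z]
      _ = (β * a + c) * ‖x - z‖ := by ring
  have hex : ∀ y ∈ S, ∃ x : X, x = A x * B y + C x := by
    intro y hy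
    have hK : ContractingWith ⟨β * a + c, by positivity⟩ fun x => A x * B y + C x := by
      refine ⟨by exact_mod_cast hcontr, LipschitzWith.of_dist_le_mul fun x z => ?_⟩
      rw [dist_eq_norm, dist_eq_norm]
      exact hlip y hy x z
    exact ⟨_, hK.fixedPoint_isFixedPt.symm⟩
  have huniq : ∀ y ∈ S, ∀ x z : X, x = A x * B y + C x → z = A z * B y + C z → x = z := by
    intro y hy x z hx hz
    have h := hlip y hy x z
    rw [← hx, ← hz] at h
    refine sub_eq_zero.1 (norm_eq_zero.1 ?_)
    nlinarith [norm_nonneg (x - z)]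
  have hex' : ∀ y : X, ∃ x : X, y ∈ S → x = A x * B y + C x := by
    intro y
    by_cases hy : y ∈ S
    · exact (hex y hy).imp fun _ h _ => h
    · exact ⟨0, fun h => absurd h hy⟩
  choose N hN using hex'
  have hNS : Set.MapsTo N S S := fun y hy => hclosure _ y hy (hN y hy)
  have hsub : ∀ v : ℕ → X, (∀ n, v n ∈ S) →
      ∃ z φ, StrictMono φ ∧ WeakConv (fun n => N (v (φ n))) z := by
    intro v hv
    obtain ⟨p, φ, hφ, hp⟩ := hA (fun n => A (N (v n))) fun n => ⟨_, hNS (hv n), rfl⟩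
    obtain ⟨q, ψ, hψ, hq⟩ := hB (fun n => B (v (φ n))) fun n => ⟨_, hv _, rfl⟩
    obtain ⟨r, χ, hχ, hr⟩ := hC (fun n => C (N (v (φ (ψ n))))) fun n => ⟨_, hNS (hv _), rfl⟩
    refine ⟨p * q + r, fun n => φ (ψ (χ n)), hφ.comp (hψ.comp hχ), ?_⟩
    have h := (hP _ _ _ _ (hp.subseq (hψ.comp hχ)) (hq.subseq hχ)).add hr
    intro f
    refine (h f).congr fun n => congrArg f ?_
    exact (hN _ (hv _)).symm
  have hNcomp : RelWeaklySeqCompact (N '' S) := by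
    intro u hu
    choose v hv hvu using hu
    obtain ⟨z, φ, hφ, hz⟩ := hsub v hv
    refine ⟨z, φ, hφ, ?_⟩
    obtain rfl : (fun n => N (v n)) = u := funext hvu
    exact hz
  have hNwsc : ∀ (u : ℕ → X) (x : X), (∀ n, u n ∈ S) → x ∈ S →
      WeakConv u x → WeakConv (fun n => N (u n)) (N x) := by
    intro u x hu hx hux f
    refine tendsto_of_subseq_tendsto fun ns hns => ?_
    obtain ⟨z, φ, hφ, hz⟩ := hsub (fun n => u (ns n)) fun n => hu _
    have hv : WeakConv (fun n => u (ns (φ n))) x :=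
      fun g => (hux g).comp (hns.comp hφ.tendsto_atTop)
    have hz' : WeakConv (fun n => N (u (ns (φ n)))) (A z * B x + C z) := by
      have h := (hP _ _ _ _ (hAwsc _ _ hz) (hBwsc _ _ (fun n => hu _) hx hv)).add
        (hCwsc _ _ hz)
      intro g
      refine (h g).congr fun n => congrArg g ?_
      exact (hN _ (hu _)).symm
    obtain rfl : z = N x := huniq x hx _ _ (hz.unique hz') (hN x hx)
    exact ⟨φ, hz f⟩
  obtain ⟨x, hx, hfix⟩ :=
    exists_fixedPoint_of_relWeaklySeqCompact hne hcl hconv hNS hNwsc hNcomp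
  refine ⟨x, hx, ?_⟩
  have h := hN x hx
  rwa [hfix] at h
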